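/- Let m ≥ 0, η ∈ ℝ, and set D₀ = -i σ·∇ + m σ₃ acting on smooth compactly supported ℂ²-valued functions on ℝ². Then for every a ∈ ℝ² and every ψ ∈ C_c^∞(ℝ², ℂ²), one has ‖ |x-a|^{1/2} (D₀ - iη) |x-a|^{1/2} ψ ‖²_{L²} ≥ (1/4) ‖ψ‖²_{L²}. -/

import Mathlib

open MeasureTheory

/-- Partial derivative in direction `j` of a spinor-valued function on `ℝ²`. -/
noncomputable def partialDeriv2 (ψ : EuclideanSpace ℝ (Fin 2) → Fin 2 → ℂ) (j : Fin 2)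
    (x : EuclideanSpace ℝ (Fin 2)) : Fin 2 → ℂ :=
  fderiv ℝ ψ x (EuclideanSpace.single j 1)

/-- The free two-dimensional Dirac operator `D₀ = -i σ·∇ + m σ₃`,
written out componentwise with the standard Pauli matrices. -/
noncomputable def diracOp (m : ℝ) (ψ : EuclideanSpace ℝ (Fin 2) → Fin 2 → ℂ)
    (x : EuclideanSpace ℝ (Fin 2)) : Fin 2 → ℂ :=
  ![ -Complex.I * partialDeriv2 ψ 0 x 1 - partialDeriv2 ψ 1 x 1 + (m : ℂ) * ψ x 0,
     -Complex.I * partialDeriv2 ψ 0 x 0 + partialDeriv2 ψ 1 x 0 - (m : ℂ) * ψ x 1 ]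

open ComplexConjugate

theorem fourierCoeffOn_neg_I_mul_deriv_add_half (s : ℤ) {h h' : ℝ → ℂ}
    (hab : -Real.pi < Real.pi)
    (hd : ∀ t, HasDerivAt h (h' t) t) (hc : Continuous h') (hper : h Real.pi = h (-Real.pi))
    (n : ℤ) :
    fourierCoeffOn hab (fun t => -Complex.I * s * h' t + h t / 2) n
      = (s * n + 1 / 2) * fourierCoeffOn hab h n := by
  have hch : Continuous h := continuous_iff_continuousAt.2 fun t => (hd t).continuousAt
  have hlin : fourierCoeffOn hab (fun t => -Complex.I * s * h' t + h t / 2) n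
      = -Complex.I * s * fourierCoeffOn hab h' n + fourierCoeffOn hab h n / 2 := by
    have hF : Continuous fun x : ℝ =>
        fourier (-n) (x : AddCircle (Real.pi - -Real.pi)) :=
      (map_continuous _).comp (AddCircle.continuous_mk' _)
    have e : ∀ x : ℝ, fourier (-n) (x : AddCircle (Real.pi - -Real.pi)) *
        (-Complex.I * s * h' x + h x / 2)
        = -Complex.I * s * (fourier (-n) (x : AddCircle (Real.pi - -Real.pi)) * h' x)
          + 1 / 2 * (fourier (-n) (x : AddCircle (Real.pi - -Real.pi)) * h x) :=
      fun x => by ring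
    simp only [fourierCoeffOn_eq_integral, smul_eq_mul, e]
    rw [intervalIntegral.integral_add
      ((by fun_prop : Continuous fun x : ℝ => -Complex.I * s *
        (fourier (-n) (x : AddCircle (Real.pi - -Real.pi)) * h' x)).intervalIntegrable _ _)
      ((by fun_prop : Continuous fun x : ℝ => (1 / 2 : ℂ) *
        (fourier (-n) (x : AddCircle (Real.pi - -Real.pi)) * h x)).intervalIntegrable _ _),
      intervalIntegral.integral_const_mul, intervalIntegral.integral_const_mul]
    simp only [Complex.real_smul]
    ring
  rw [hlin]
  rcases eq_or_ne n 0 with rfl | hn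
  · have : fourierCoeffOn hab h' 0 = 0 := by
      simp [fourierCoeffOn_eq_integral, intervalIntegral.integral_eq_sub_of_hasDerivAt
        (fun t _ => hd t) (hc.intervalIntegrable _ _), hper]
    rw [this]; push_cast; ring
  · rw [fourierCoeffOn_of_hasDerivAt hab hn (fun t _ => hd t) (hc.intervalIntegrable _ _), hper]
    have hn' : (n : ℂ) ≠ 0 := by exact_mod_cast hn
    have hpi : (Real.pi : ℂ) ≠ 0 := by exact_mod_cast Real.pi_ne_zero
    push_cast
    field_simp
    linear_combination (-(4 * s * fourierCoeffOn hab h' n * Real.pi * n) : ℂ) * Complex.I_sq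

theorem quarter_mul_integral_norm_sq_le (s : ℤ) {h h' : ℝ → ℂ}
    (hd : ∀ t, HasDerivAt h (h' t) t) (hc : Continuous h') (hper : h Real.pi = h (-Real.pi)) :
    1 / 4 * ∫ t in (-Real.pi)..Real.pi, ‖h t‖ ^ 2
      ≤ ∫ t in (-Real.pi)..Real.pi, ‖-Complex.I * s * h' t + h t / 2‖ ^ 2 := by
  have hab : -Real.pi < Real.pi := by linarith [Real.pi_pos]
  have hch : Continuous h := continuous_iff_continuousAt.2 fun t => (hd t).continuousAt
  have key : ∀ {k : ℝ → ℂ}, Continuous k →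
      MemLp k 2 (volume.restrict (Set.Ioc (-Real.pi) Real.pi)) := fun {k} hk =>
    (memLp_two_iff_integrable_sq_norm hk.aestronglyMeasurable).2
      ((by fun_prop : Continuous fun t => ‖k t‖ ^ 2).integrableOn_Ioc)
  have h1 := hasSum_sq_fourierCoeffOn hab (key hch)
  have h2 := hasSum_sq_fourierCoeffOn hab
    (key (k := fun t => -Complex.I * s * h' t + h t / 2) (by fun_prop))
  have h3 := hasSum_le (fun n => ?_) (h1.mul_left (1 / 4)) h2
  · simp only [smul_eq_mul] at h3
    have : 0 < (Real.pi - -Real.pi)⁻¹ := inv_pos.2 (by linarith)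
    refine le_of_mul_le_mul_left ?_ this
    linarith
  · rw [fourierCoeffOn_neg_I_mul_deriv_add_half s hab hd hc hper, norm_mul, mul_pow]
    gcongr
    have e : ((s : ℂ) * n + 1 / 2) = (((s * n : ℤ) + 1 / 2 : ℝ) : ℂ) := by push_cast; ring
    rw [e, Complex.norm_real, Real.norm_eq_abs, sq_abs]
    have : (0 : ℝ) ≤ ((s * n * (s * n + 1) : ℤ) : ℝ) := by
      have : 0 ≤ s * n * (s * n + 1) := by
        rcases le_or_gt 0 (s * n) with h | h
        · positivity
        · nlinarith
      exact_mod_cast this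
    push_cast at this ⊢
    nlinarith

theorem integrable_fderiv_mul {u : ℂ → ℝ} (hu : ContDiff ℝ 1 u) (hs : HasCompactSupport u)
    {k : ℂ → ℝ} (hk : Continuous k) (v : ℂ) : Integrable fun z => k z * fderiv ℝ u z v := by
  refine Continuous.integrable_of_hasCompactSupport
    (hk.mul ((hu.continuous_fderiv one_ne_zero).clm_apply continuous_const)) ?_
  exact ((hs.fderiv (𝕜 := ℝ)).comp_left (g := fun L : ℂ →L[ℝ] ℝ => L v) (by simp)).mul_left

theorem integral_clm_mul_fderiv {u : ℂ → ℝ} (hu : ContDiff ℝ 1 u) (hs : HasCompactSupport u)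
    (k : ℂ →L[ℝ] ℝ) (v : ℂ) :
    ∫ z, k z * fderiv ℝ u z v = - (k v * ∫ z, u z) := by
  rw [integral_mul_fderiv_eq_neg_fderiv_mul_of_integrable]
  · simp [integral_const_mul]
  · simpa using (hu.continuous.integrable_of_hasCompactSupport hs).const_mul (k v)
  · exact integrable_fderiv_mul hu hs k.continuous v
  · exact (k.continuous.mul hu.continuous).integrable_of_hasCompactSupport hs.mul_left
  · exact fun x _ => k.differentiableAt
  · exact fun x _ => hu.differentiable one_ne_zero x

theorem integral_fderiv_I_mul {u : ℂ → ℝ} (hu : ContDiff ℝ 1 u) (hs : HasCompactSupport u) :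
    ∫ z, fderiv ℝ u z (Complex.I * z) = 0 := by
  have e : ∀ z : ℂ, fderiv ℝ u z (Complex.I * z)
      = Complex.reCLM z * fderiv ℝ u z Complex.I - Complex.imCLM z * fderiv ℝ u z 1 := by
    intro z
    have : Complex.I * z = z.re • Complex.I - z.im • (1 : ℂ) := by
      apply Complex.ext <;> simp
    rw [this]; simp only [map_sub, map_smul, smul_eq_mul]; rfl
  simp only [e]
  rw [integral_sub (integrable_fderiv_mul hu hs Complex.reCLM.continuous _)
    (integrable_fderiv_mul hu hs Complex.imCLM.continuous _), integral_clm_mul_fderiv hu hs,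
    integral_clm_mul_fderiv hu hs]
  simp

theorem integral_fderiv_self {u : ℂ → ℝ} (hu : ContDiff ℝ 1 u) (hs : HasCompactSupport u) :
    ∫ z, fderiv ℝ u z z = - (2 * ∫ z, u z) := by
  have e : ∀ z : ℂ, fderiv ℝ u z z
      = Complex.reCLM z * fderiv ℝ u z 1 + Complex.imCLM z * fderiv ℝ u z Complex.I := by
    intro z
    have : fderiv ℝ u z z = fderiv ℝ u z (z.re • (1 : ℂ) + z.im • Complex.I) := by
      congr 1; apply Complex.ext <;> simp
    rw [this]; simp only [map_add, map_smul, smul_eq_mul]; rfl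
  simp only [e]
  rw [integral_add (integrable_fderiv_mul hu hs Complex.reCLM.continuous _)
    (integrable_fderiv_mul hu hs Complex.imCLM.continuous _), integral_clm_mul_fderiv hu hs,
    integral_clm_mul_fderiv hu hs]
  simp
  ring

theorem hasCompactSupport_fderiv_apply {F : Type*} [NormedAddCommGroup F] [NormedSpace ℝ F]
    {f : ℂ → F} (hs : HasCompactSupport f) (k : ℂ → ℂ) :
    HasCompactSupport fun z => fderiv ℝ f z (k z) :=
  (hs.fderiv (𝕜 := ℝ)).mono' fun z hz => subset_tsupport _ fun h => hz (by simp [h])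

theorem quarter_mul_integral_norm_sq_le_rot (s : ℤ) {f : ℂ → ℂ} (hf : ContDiff ℝ 1 f)
    (hs : HasCompactSupport f) :
    1 / 4 * ∫ z, ‖f z‖ ^ 2
      ≤ ∫ z, ‖-Complex.I * s * fderiv ℝ f z (Complex.I * z) + f z / 2‖ ^ 2 := by
  have hcf := hf.continuous
  have hcd : Continuous fun z => fderiv ℝ f z (Complex.I * z) :=
    (hf.continuous_fderiv one_ne_zero).clm_apply (by fun_prop)
  have hsd : HasCompactSupport fun z => fderiv ℝ f z (Complex.I * z) :=
    hasCompactSupport_fderiv_apply hs _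
  have i1 : Integrable fun z => ‖f z‖ ^ 2 :=
    Continuous.integrable_of_hasCompactSupport (by fun_prop)
      (hs.comp_left (g := fun w => ‖w‖ ^ 2) (by simp))
  have i2 : Integrable fun z =>
      ‖-Complex.I * s * fderiv ℝ f z (Complex.I * z) + f z / 2‖ ^ 2 := by
    refine Continuous.integrable_of_hasCompactSupport (by fun_prop) ?_
    refine HasCompactSupport.comp_left (g := fun w : ℂ => ‖w‖ ^ 2) ?_ (by simp)
    refine (hsd.mul_left (f := fun _ => -Complex.I * s)).add ?_
    exact hs.comp_left (g := fun w => w / 2) (by simp)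
  rw [← sub_nonneg, ← integral_const_mul, ← integral_sub i2 (i1.const_mul _),
    ← Complex.integral_comp_polarCoord_symm, polarCoord_target]
  set F : ℝ × ℝ → ℝ := _ with hF
  change 0 ≤ ∫ p in _, F p
  by_cases hi : IntegrableOn F (Set.Ioi (0 : ℝ) ×ˢ Set.Ioo (-Real.pi) Real.pi)
  swap
  · rw [integral_undef hi]
  rw [Measure.volume_eq_prod] at hi ⊢
  rw [setIntegral_prod _ hi]
  refine setIntegral_nonneg measurableSet_Ioi fun r hr => ?_
  have hr : (0 : ℝ) < r := hr
  simp only [hF, Complex.polarCoord_symm_apply, smul_eq_mul]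
  rw [integral_const_mul]
  refine mul_nonneg hr.le ?_
  let c : ℝ → ℂ := fun t => r * (Real.cos t + Real.sin t * Complex.I)
  have hc : ∀ t, HasDerivAt c (Complex.I * c t) t := by
    intro t
    have := (((Real.hasDerivAt_cos t).ofReal_comp).add
      (((Real.hasDerivAt_sin t).ofReal_comp).mul_const Complex.I)).const_mul (r : ℂ)
    refine this.congr_deriv ?_
    simp only [c]
    push_cast
    linear_combination -(r * Complex.sin t : ℂ) * Complex.I_sq
  have hcc : Continuous c := continuous_iff_continuousAt.2 fun t => (hc t).continuousAt
  have main := quarter_mul_integral_norm_sq_le s (h := f ∘ c)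
    (h' := fun t => fderiv ℝ f (c t) (Complex.I * c t))
    (fun t => ((hf.differentiable one_ne_zero (c t)).hasFDerivAt).comp_hasDerivAt t (hc t))
    (hcd.comp hcc) (by simp [c])
  rw [← integral_Ioc_eq_integral_Ioo, ← intervalIntegral.integral_of_le
    (by linarith [Real.pi_pos]), intervalIntegral.integral_sub,
    intervalIntegral.integral_const_mul, sub_nonneg]
  · exact main
  · have : Continuous fun t =>
      ‖-Complex.I * s * fderiv ℝ f (c t) (Complex.I * c t) + f (c t) / 2‖ ^ 2 := by
      have := hcd.comp hcc
      simp only [Function.comp_def] at this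
      fun_prop
    exact this.intervalIntegrable _ _
  · have : Continuous fun t => 1 / 4 * ‖f (c t)‖ ^ 2 := by fun_prop
    exact this.intervalIntegrable _ _

theorem integrable_fderiv_apply {u : ℂ → ℝ} (hu : ContDiff ℝ 1 u) (hs : HasCompactSupport u)
    {k : ℂ → ℂ} (hk : Continuous k) : Integrable fun z => fderiv ℝ u z (k z) :=
  ((hu.continuous_fderiv one_ne_zero).clm_apply hk).integrable_of_hasCompactSupport
    (hasCompactSupport_fderiv_apply hs k)

theorem contDiff_fderiv_clm {f : ℂ → ℂ} (hf : ContDiff ℝ 2 f) (A : ℂ →L[ℝ] ℂ) :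
    ContDiff ℝ 1 fun z => fderiv ℝ f z (A z) :=
  (hf.fderiv_right (m := 1) (by norm_num)).clm_apply A.contDiff

theorem fderiv_fderiv_clm {f : ℂ → ℂ} (hf : ContDiff ℝ 2 f) (A : ℂ →L[ℝ] ℂ) (z v : ℂ) :
    fderiv ℝ (fun z => fderiv ℝ f z (A z)) z v
      = fderiv ℝ (fderiv ℝ f) z v (A z) + fderiv ℝ f z (A v) := by
  have h := ((((hf.fderiv_right (m := 1) (by norm_num)).differentiable one_ne_zero
    z).hasFDerivAt).clm_apply A.hasFDerivAt).fderiv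
  rw [h]
  simp [add_comm]

theorem fderiv_fderiv_I_mul_comm {f : ℂ → ℂ} (hf : ContDiff ℝ 2 f) (z : ℂ) :
    fderiv ℝ (fun z => fderiv ℝ f z (Complex.I * z)) z z
      = fderiv ℝ (fun z => fderiv ℝ f z z) z (Complex.I * z) := by
  have h1 := fderiv_fderiv_clm hf (ContinuousLinearMap.mul ℝ ℂ Complex.I) z z
  have h2 := fderiv_fderiv_clm hf (.id ℝ ℂ) z (Complex.I * z)
  have hsym := (hf.contDiffAt (x := z)).isSymmSndFDerivAt (by simp)
  simp only [ContinuousLinearMap.mul_apply', ContinuousLinearMap.id_apply] at h1 h2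
  rw [h1, h2, hsym.eq]

theorem fderiv_clm_conj_mul (L : ℂ →L[ℝ] ℝ) {p q : ℂ → ℂ} (hp : Differentiable ℝ p)
    (hq : Differentiable ℝ q) (z v : ℂ) :
    fderiv ℝ (fun z => L (conj (p z) * q z)) z v
      = L (conj (fderiv ℝ p z v) * q z + conj (p z) * fderiv ℝ q z v) := by
  have hc : HasFDerivAt (fun z => conj (p z)) _ z :=
    (Complex.conjCLE.toContinuousLinearMap.hasFDerivAt).comp z (hp z).hasFDerivAt
  have h := (L.hasFDerivAt.comp z (hc.mul (hq z).hasFDerivAt)).fderiv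
  change fderiv ℝ (L ∘ _) z v = _
  simp only [Function.comp_def, Pi.mul_apply] at h ⊢
  rw [h]
  simp
  ring_nf

theorem contDiff_clm_conj_mul (L : ℂ →L[ℝ] ℝ) {p q : ℂ → ℂ} (hp : ContDiff ℝ 1 p)
    (hq : ContDiff ℝ 1 q) : ContDiff ℝ 1 fun z => L (conj (p z) * q z) :=
  L.contDiff.comp ((Complex.conjCLE.contDiff.comp hp).mul hq)

theorem hasCompactSupport_clm_conj_mul (L : ℂ →L[ℝ] ℝ) (p : ℂ → ℂ) {q : ℂ → ℂ}
    (hq : HasCompactSupport q) : HasCompactSupport fun z => L (conj (p z) * q z) :=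
  (hq.mul_left (f := fun z => conj (p z))).comp_left (g := L) (by simp)

theorem integral_im_conj_rot_mul {f : ℂ → ℂ} (hf : ContDiff ℝ 2 f) (hs : HasCompactSupport f) :
    ∫ z, (conj (fderiv ℝ f z (Complex.I * z)) * (fderiv ℝ f z z + f z)).im = 0 := by
  have hf1 : ContDiff ℝ 1 f := hf.of_le (by norm_num)
  have hR : ContDiff ℝ 1 fun z => fderiv ℝ f z (Complex.I * z) :=
    contDiff_fderiv_clm hf (ContinuousLinearMap.mul ℝ ℂ Complex.I)
  have hE : ContDiff ℝ 1 fun z => fderiv ℝ f z z := contDiff_fderiv_clm hf (.id ℝ ℂ)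
  have hu := contDiff_clm_conj_mul Complex.imCLM hR hf1
  have hus := hasCompactSupport_clm_conj_mul Complex.imCLM
    (fun z => fderiv ℝ f z (Complex.I * z)) hs
  have hw := contDiff_clm_conj_mul Complex.imCLM hE hf1
  have hws := hasCompactSupport_clm_conj_mul Complex.imCLM (fun z => fderiv ℝ f z z) hs
  have h1 := integral_fderiv_self hu hus
  have h2 := integral_fderiv_I_mul hw hws
  have i1 := integrable_fderiv_apply hu hus (k := fun z => z) continuous_id
  have i2 := integrable_fderiv_apply hw hws (k := fun z => Complex.I * z) (by fun_prop)
  have i3 := hu.continuous.integrable_of_hasCompactSupport hus (μ := volume)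
  have e : ∀ z, (conj (fderiv ℝ f z (Complex.I * z)) * (fderiv ℝ f z z + f z)).im
      = 1 / 2 * (fderiv ℝ (fun z => Complex.imCLM
          (conj (fderiv ℝ f z (Complex.I * z)) * f z)) z z
        + 2 * Complex.imCLM (conj (fderiv ℝ f z (Complex.I * z)) * f z)
        - fderiv ℝ (fun z => Complex.imCLM (conj (fderiv ℝ f z z) * f z)) z
          (Complex.I * z)) := by
    intro z
    rw [fderiv_clm_conj_mul _ (hR.differentiable one_ne_zero) (hf1.differentiable one_ne_zero),
      fderiv_clm_conj_mul _ (hE.differentiable one_ne_zero) (hf1.differentiable one_ne_zero),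
      fderiv_fderiv_I_mul_comm hf]
    simp
    ring
  simp only [e]
  rw [integral_const_mul, integral_sub (by exact i1.add (i3.const_mul 2)) i2,
    integral_add i1 (i3.const_mul 2), integral_const_mul, h2]
  rw [h1]
  ring

theorem integral_re_conj_mul_euler {f : ℂ → ℂ} (hf : ContDiff ℝ 1 f)
    (hs : HasCompactSupport f) :
    ∫ z, (conj (f z) * (fderiv ℝ f z z + f z)).re = 0 := by
  have hu := contDiff_clm_conj_mul Complex.reCLM hf hf
  have hus := hasCompactSupport_clm_conj_mul Complex.reCLM f hs
  have h1 := integral_fderiv_self hu hus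
  have i1 := integrable_fderiv_apply hu hus (k := fun z => z) continuous_id
  have i3 := hu.continuous.integrable_of_hasCompactSupport hus (μ := volume)
  have e : ∀ z, (conj (f z) * (fderiv ℝ f z z + f z)).re
      = 1 / 2 * (fderiv ℝ (fun z => Complex.reCLM (conj (f z) * f z)) z z
        + 2 * Complex.reCLM (conj (f z) * f z)) := by
    intro z
    rw [fderiv_clm_conj_mul _ (hf.differentiable one_ne_zero) (hf.differentiable one_ne_zero)]
    simp
    ring
  simp only [e]
  rw [integral_const_mul, integral_add i1 (i3.const_mul 2), integral_const_mul]
  rw [h1]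
  ring

theorem integral_re_offdiag {f g : ℂ → ℂ} (hf : ContDiff ℝ 1 f) (hg : ContDiff ℝ 1 g)
    (hs : HasCompactSupport g) (c : ℂ) :
    ∫ z, (c * conj z * (conj (f z) * g z + Complex.I * (conj (fderiv ℝ f z (Complex.I * z)) * g z
      + conj (f z) * fderiv ℝ g z (Complex.I * z)))).re = 0 := by
  let L : ℂ →L[ℝ] ℝ := Complex.reCLM.comp (ContinuousLinearMap.mul ℝ ℂ (c * Complex.I))
  have hp : ContDiff ℝ 1 fun z : ℂ => z * f z := contDiff_id.mul hf
  have hu := contDiff_clm_conj_mul L hp hg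
  have hus := hasCompactSupport_clm_conj_mul L (fun z : ℂ => z * f z) hs
  rw [← integral_fderiv_I_mul hu hus]
  congr 1 with z
  have : fderiv ℝ (fun z : ℂ => z * f z) z (Complex.I * z)
      = z * fderiv ℝ f z (Complex.I * z) + Complex.I * z * f z := by
    have h := (hasFDerivAt_id (𝕜 := ℝ) z).mul (hf.differentiable one_ne_zero z).hasFDerivAt
    have h' : HasFDerivAt (fun z : ℂ => z * f z) _ z := h
    rw [h'.fderiv]
    simp [mul_comm]
  rw [fderiv_clm_conj_mul _ (hp.differentiable one_ne_zero) (hg.differentiable one_ne_zero), this]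
  simp only [L, ContinuousLinearMap.comp_apply, ContinuousLinearMap.mul_apply',
    Complex.reCLM_apply]
  simp only [map_add, map_mul, Complex.conj_I]
  refine congrArg Complex.re ?_
  linear_combination (c * conj z * conj (f z) * g z) * Complex.I_sq

theorem norm_sq_sub_add_norm_sq_sub (c z f g ef eg rf rg : ℂ) :
    ‖ef + Complex.I * rf + f / 2 + c * conj z * g‖ ^ 2
      + ‖eg - Complex.I * rg + g / 2 + conj c * z * f‖ ^ 2
    = ‖ef + f + c * conj z * g‖ ^ 2 + ‖eg + g + conj c * z * f‖ ^ 2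
      + (‖-Complex.I * rf + f / 2‖ ^ 2 + ‖Complex.I * rg + g / 2‖ ^ 2
      - 2 * (-(conj rf * (ef + f)).im + (conj rg * (eg + g)).im
        + 1 / 2 * (conj f * (ef + f)).re + 1 / 2 * (conj g * (eg + g)).re
        + (c * conj z * (conj f * g + Complex.I * (conj rf * g + conj f * rg))).re)) := by
  simp only [Complex.sq_norm, Complex.normSq_apply, div_eq_mul_inv]
  have h2r : (2⁻¹ : ℂ).re = 1 / 2 := by norm_num
  have h2i : (2⁻¹ : ℂ).im = 0 := by norm_num
  simp only [Complex.add_re, Complex.add_im, Complex.sub_re, Complex.sub_im, Complex.mul_re,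
    Complex.mul_im, Complex.neg_re, Complex.neg_im, Complex.I_re, Complex.I_im, Complex.conj_re,
    Complex.conj_im, h2r, h2i]
  ring

theorem quarter_mul_integral_le_complex {f g : ℂ → ℂ} (hf : ContDiff ℝ 2 f)
    (hg : ContDiff ℝ 2 g) (hfs : HasCompactSupport f) (hgs : HasCompactSupport g) (c : ℂ) :
    1 / 4 * ∫ z, (‖f z‖ ^ 2 + ‖g z‖ ^ 2)
      ≤ ∫ z, (‖fderiv ℝ f z z + Complex.I * fderiv ℝ f z (Complex.I * z) + f z / 2
          + c * conj z * g z‖ ^ 2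
        + ‖fderiv ℝ g z z - Complex.I * fderiv ℝ g z (Complex.I * z) + g z / 2
          + conj c * z * f z‖ ^ 2) := by
  have hf1 : ContDiff ℝ 1 f := hf.of_le (by norm_num)
  have hg1 : ContDiff ℝ 1 g := hg.of_le (by norm_num)
  have cf := hf.continuous
  have cg := hg.continuous
  have cE : ∀ {h : ℂ → ℂ}, ContDiff ℝ 1 h → Continuous fun z => fderiv ℝ h z z :=
    fun hh => (hh.continuous_fderiv one_ne_zero).clm_apply continuous_id
  have cR : ∀ {h : ℂ → ℂ}, ContDiff ℝ 1 h → Continuous fun z => fderiv ℝ h z (Complex.I * z) :=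
    fun hh => (hh.continuous_fderiv one_ne_zero).clm_apply (by fun_prop)
  have cEf := cE hf1
  have cEg := cE hg1
  have cRf := cR hf1
  have cRg := cR hg1
  have hK : IsCompact (tsupport f ∪ tsupport g) := hfs.isCompact.union hgs.isCompact
  have out : ∀ z, z ∉ tsupport f ∪ tsupport g →
      f z = 0 ∧ g z = 0 ∧ fderiv ℝ f z = 0 ∧ fderiv ℝ g z = 0 := by
    intro z hz
    rw [Set.mem_union, not_or] at hz
    exact ⟨image_eq_zero_of_notMem_tsupport hz.1, image_eq_zero_of_notMem_tsupport hz.2,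
      by_contra fun h => hz.1 (support_fderiv_subset ℝ h),
      by_contra fun h => hz.2 (support_fderiv_subset ℝ h)⟩
  have int : ∀ {k : ℂ → ℝ}, Continuous k → (∀ z, f z = 0 → g z = 0 → fderiv ℝ f z = 0 →
      fderiv ℝ g z = 0 → k z = 0) → Integrable k := fun {k} hk h0 =>
    hk.integrable_of_hasCompactSupport (HasCompactSupport.intro hK fun z hz => by
      obtain ⟨a, b, c, d⟩ := out z hz
      exact h0 z a b c d)
  have iQf : Integrable fun z => ‖-Complex.I * fderiv ℝ f z (Complex.I * z) + f z / 2‖ ^ 2 :=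
    int (by fun_prop) (by intro z h1 h2 h3 h4; simp [h1, h3])
  have iQg : Integrable fun z => ‖Complex.I * fderiv ℝ g z (Complex.I * z) + g z / 2‖ ^ 2 :=
    int (by fun_prop) (by intro z h1 h2 h3 h4; simp [h2, h4])
  have iX1 : Integrable fun z =>
      (conj (fderiv ℝ f z (Complex.I * z)) * (fderiv ℝ f z z + f z)).im :=
    int (by fun_prop) (by intro z h1 h2 h3 h4; simp [h3])
  have iX2 : Integrable fun z =>
      (conj (fderiv ℝ g z (Complex.I * z)) * (fderiv ℝ g z z + g z)).im :=
    int (by fun_prop) (by intro z h1 h2 h3 h4; simp [h4])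
  have iX3 : Integrable fun z => (conj (f z) * (fderiv ℝ f z z + f z)).re :=
    int (by fun_prop) (by intro z h1 h2 h3 h4; simp [h1])
  have iX4 : Integrable fun z => (conj (g z) * (fderiv ℝ g z z + g z)).re :=
    int (by fun_prop) (by intro z h1 h2 h3 h4; simp [h2])
  have iX5 : Integrable fun z => (c * conj z * (conj (f z) * g z
      + Complex.I * (conj (fderiv ℝ f z (Complex.I * z)) * g z
      + conj (f z) * fderiv ℝ g z (Complex.I * z)))).re :=
    int (by fun_prop) (by intro z h1 h2 h3 h4; simp [h1, h2])
  have iA : Integrable fun z => ‖fderiv ℝ f z z + Complex.I * fderiv ℝ f z (Complex.I * z)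
          + f z / 2 + c * conj z * g z‖ ^ 2
        + ‖fderiv ℝ g z z - Complex.I * fderiv ℝ g z (Complex.I * z) + g z / 2
          + conj c * z * f z‖ ^ 2 :=
    int (by fun_prop) (by intro z h1 h2 h3 h4; simp [h1, h2, h3, h4])
  have ifs : Integrable fun z => ‖f z‖ ^ 2 :=
    int (by fun_prop) (by intro z h1 h2 h3 h4; simp [h1])
  have igs : Integrable fun z => ‖g z‖ ^ 2 :=
    int (by fun_prop) (by intro z h1 h2 h3 h4; simp [h2])
  have iX12 := iX1.neg.add iX2
  have iX123 := iX12.add (iX3.const_mul (1 / 2))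
  have iX1234 := iX123.add (iX4.const_mul (1 / 2))
  have iX := (iX1234.add iX5).const_mul 2
  have lower := integral_mono ((iQf.add iQg).sub iX) iA (fun z => by
    have h := norm_sq_sub_add_norm_sq_sub c z (f z) (g z) (fderiv ℝ f z z) (fderiv ℝ g z z)
      (fderiv ℝ f z (Complex.I * z)) (fderiv ℝ g z (Complex.I * z))
    simp only [Pi.add_apply, Pi.sub_apply, Pi.neg_apply]
    rw [h]
    exact le_add_of_nonneg_left (by positivity))
  rw [integral_sub' (iQf.add iQg) iX, integral_add' iQf iQg, integral_const_mul,
    integral_add' iX1234 iX5, integral_add' iX123 (iX4.const_mul _),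
    integral_add' iX12 (iX3.const_mul _), integral_add' iX1.neg iX2, integral_neg',
    integral_const_mul, integral_const_mul, integral_im_conj_rot_mul hf hfs,
    integral_im_conj_rot_mul hg hgs, integral_re_conj_mul_euler hf1 hfs,
    integral_re_conj_mul_euler hg1 hgs, integral_re_offdiag hf1 hg1 hgs c] at lower
  have wf := quarter_mul_integral_norm_sq_le_rot 1 hf1 hfs
  have wg := quarter_mul_integral_norm_sq_le_rot (-1) hg1 hgs
  push_cast at wf wg
  simp only [mul_one, mul_neg, neg_mul, neg_neg] at wf wg
  rw [integral_add ifs igs]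
  refine le_trans ?_ lower
  simp only [neg_mul]
  linarith

theorem sqrt_norm_sub_mul_partialDeriv2 {ψ : EuclideanSpace ℝ (Fin 2) → Fin 2 → ℂ}
    {a x : EuclideanSpace ℝ (Fin 2)} (hψ : DifferentiableAt ℝ ψ x) (hx : x ≠ a) (i j : Fin 2) :
    (Real.sqrt ‖x - a‖ : ℂ) * partialDeriv2 (fun y => (Real.sqrt ‖y - a‖ : ℂ) • ψ y) j x i
      = ‖x - a‖ * partialDeriv2 ψ j x i + ((x - a) j : ℂ) / (2 * ‖x - a‖) * ψ x i := by
  have hr : 0 < ‖x - a‖ := norm_pos_iff.2 (sub_ne_zero.2 hx)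
  have h1 := (((hasFDerivAt_id (𝕜 := ℝ) x).sub_const a).norm_sq.sqrt (pow_pos hr 2).ne')
  have h2 := (h1.sqrt (by simpa using hr.ne')).smul hψ.hasFDerivAt
  have e : (fun y => (Real.sqrt ‖y - a‖ : ℂ) • ψ y)
      = (fun y => Real.sqrt (Real.sqrt (‖id y - a‖ ^ 2))) • ψ := by
    funext y
    rw [Pi.smul_apply', Real.sqrt_sq (norm_nonneg _), id]
    exact Complex.coe_smul _ _
  rw [partialDeriv2, e, h2.fderiv]
  have hs : (Real.sqrt ‖x - a‖ : ℂ) * (Real.sqrt ‖x - a‖ : ℂ) = ‖x - a‖ := by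
    exact_mod_cast Real.mul_self_sqrt hr.le
  have hs0 : (Real.sqrt ‖x - a‖ : ℂ) ≠ 0 := by exact_mod_cast (Real.sqrt_pos.2 hr).ne'
  have hr0 : (‖x - a‖ : ℂ) ≠ 0 := by exact_mod_cast hr.ne'
  simp [partialDeriv2, Real.sqrt_sq hr.le, EuclideanSpace.inner_single_right]
  rw [← hs]
  field_simp

theorem fderiv_comp_orthonormalBasisOneI {ψ : EuclideanSpace ℝ (Fin 2) → Fin 2 → ℂ}
    (hψ : Differentiable ℝ ψ) (a : EuclideanSpace ℝ (Fin 2)) (i : Fin 2) (z v : ℂ) :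
    fderiv ℝ (fun z => ψ (a + Complex.orthonormalBasisOneI.repr z) i) z v
      = v.re * partialDeriv2 ψ 0 (a + Complex.orthonormalBasisOneI.repr z) i
        + v.im * partialDeriv2 ψ 1 (a + Complex.orthonormalBasisOneI.repr z) i := by
  set e := Complex.orthonormalBasisOneI.repr with he
  have h1 : HasFDerivAt (fun z => a + e z) (e : ℂ →L[ℝ] EuclideanSpace ℝ (Fin 2)) z :=
    (e : ℂ →L[ℝ] EuclideanSpace ℝ (Fin 2)).hasFDerivAt.const_add a
  have h2 : HasFDerivAt (fun z => ψ (a + e z) i) _ z :=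
    (ContinuousLinearMap.proj (R := ℝ) (φ := fun _ : Fin 2 => ℂ) i).hasFDerivAt.comp z
      ((hψ (a + e z)).hasFDerivAt.comp z h1)
  have hv : e v = v.re • EuclideanSpace.single 0 (1 : ℝ)
      + v.im • EuclideanSpace.single 1 (1 : ℝ) := by
    ext k
    fin_cases k <;> simp [he]
  rw [h2.fderiv]
  simp [partialDeriv2, hv]

theorem norm_eq_of_mul_eq {ζ w T A : ℂ} (hζ : ζ ≠ 0) (hw : ‖w‖ = ‖ζ‖)
    (h : ‖ζ‖ * A = Complex.I * w * T) : ‖T‖ = ‖A‖ := by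
  have h' := congrArg norm h
  simp only [norm_mul, Complex.norm_I, one_mul, hw, Complex.norm_real, norm_norm] at h'
  exact (mul_left_cancel₀ (norm_ne_zero_iff.2 hζ) h').symm

/-- `‖ |x-a|^{1/2} (D₀ - iη) |x-a|^{1/2} ψ ‖² ≥ (1/4) ‖ψ‖²` for all
`ψ ∈ C_c^∞(ℝ², ℂ²)`, `a ∈ ℝ²`, `η ∈ ℝ` and mass `m ≥ 0`. -/
theorem sandwich_inequality_2d (m η : ℝ) (hm : 0 ≤ m) (a : EuclideanSpace ℝ (Fin 2))
    (ψ : EuclideanSpace ℝ (Fin 2) → Fin 2 → ℂ) (hsmooth : ContDiff ℝ (⊤ : ℕ∞) ψ)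
    (hsupp : HasCompactSupport ψ) :
    (∫ x : EuclideanSpace ℝ (Fin 2),
        (‖(Real.sqrt ‖x - a‖ : ℂ) •
            (diracOp m (fun y => (Real.sqrt ‖y - a‖ : ℂ) • ψ y) x
              - (Complex.I * η) • ((Real.sqrt ‖x - a‖ : ℂ) • ψ x)) 0‖ ^ 2
          + ‖(Real.sqrt ‖x - a‖ : ℂ) •
            (diracOp m (fun y => (Real.sqrt ‖y - a‖ : ℂ) • ψ y) x
              - (Complex.I * η) • ((Real.sqrt ‖x - a‖ : ℂ) • ψ x)) 1‖ ^ 2))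
      ≥ (1/4) * ∫ x : EuclideanSpace ℝ (Fin 2), (‖ψ x 0‖ ^ 2 + ‖ψ x 1‖ ^ 2) := by
  set e := Complex.orthonormalBasisOneI.repr with he
  have change_var : ∀ H : EuclideanSpace ℝ (Fin 2) → ℝ, ∫ x, H x = ∫ z : ℂ, H (a + e z) := by
    intro H
    rw [← integral_add_left_eq_self H a]
    exact (e.measurePreserving.integral_comp e.toHomeomorph.measurableEmbedding
      (fun x => H (a + x))).symm
  rw [change_var, change_var, ge_iff_le]
  have smooth : ∀ i, ContDiff ℝ 2 fun z => ψ (a + e z) i := by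
    intro i
    have h : ContDiff ℝ 2 ψ := hsmooth.of_le (WithTop.coe_le_coe.2 le_top)
    exact (contDiff_pi.1 h i).comp (contDiff_const.add e.contDiff)
  have supp : ∀ i, HasCompactSupport fun z => ψ (a + e z) i := by
    intro i
    have h1 : HasCompactSupport fun x => ψ x i :=
      hsupp.comp_left (g := fun v : Fin 2 → ℂ => v i) rfl
    exact h1.comp_homeomorph (e.toHomeomorph.trans (Homeomorph.addLeft a))
  have hψ : Differentiable ℝ ψ := hsmooth.differentiable (by simp)
  refine (quarter_mul_integral_le_complex (smooth 0) (smooth 1) (supp 0) (supp 1)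
    (η - m * Complex.I)).trans_eq (integral_congr_ae ?_)
  filter_upwards [compl_mem_ae_iff.2 (measure_singleton (0 : ℂ))] with z hz
  have hz : z ≠ 0 := hz
  have hx : a + e z ≠ a := by simpa using hz
  have hd := fun i v => fderiv_comp_orthonormalBasisOneI hψ a i z v
  simp only [← he] at hd
  simp only [hd]
  have p := sqrt_norm_sub_mul_partialDeriv2 (hψ (a + e z)) hx
  have p00 := p 0 0
  have p01 := p 0 1
  have p10 := p 1 0
  have p11 := p 1 1
  have hn : ‖a + e z - a‖ = ‖z‖ := by simp
  have h0 : (a + e z - a) 0 = z.re := by simp [he]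
  have h1 : (a + e z - a) 1 = z.im := by simp [he]
  simp only [hn, h0, h1] at p00 p01 p10 p11
  have hs : (Real.sqrt ‖z‖ : ℂ) * (Real.sqrt ‖z‖ : ℂ) = ‖z‖ := by
    exact_mod_cast Real.mul_self_sqrt (norm_nonneg z)
  have hr : (‖z‖ : ℂ) ≠ 0 := by exact_mod_cast norm_ne_zero_iff.2 hz
  have hsq : (‖z‖ : ℂ) ^ 2 = z.re ^ 2 + z.im ^ 2 := by
    have := Complex.sq_norm z
    rw [Complex.normSq_apply] at this
    rw [← Complex.ofReal_pow, this]; push_cast; ring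
  have hzz : z = z.re + z.im * Complex.I := (Complex.re_add_im z).symm
  have hzc : conj z = z.re - z.im * Complex.I := by
    apply Complex.ext <;> simp
  have hcc : conj ((η : ℂ) - m * Complex.I) = η + m * Complex.I := by
    apply Complex.ext <;> simp
  have hinv : (‖z‖ : ℂ) = (z.re ^ 2 + z.im ^ 2) * (‖z‖ : ℂ)⁻¹ := by
    rw [← hsq]; field_simp
  have hIre : (Complex.I * z).re = -z.im := by simp
  have hIim : (Complex.I * z).im = z.re := by simp
  rw [add_comm (‖_‖ ^ 2) (‖_‖ ^ 2)]
  simp only [hn, diracOp, Pi.sub_apply, Pi.smul_apply, smul_eq_mul, Matrix.cons_val_zero,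
    Matrix.cons_val_one, hIre, hIim, Complex.ofReal_neg, hzc, hcc]
  set x : ℂ := (z.re : ℂ)
  set y : ℂ := (z.im : ℂ)
  set r : ℂ := (‖z‖ : ℂ)
  congr 2
  · refine (norm_eq_of_mul_eq (w := x + y * Complex.I) hz (by rw [← hzz]) ?_).symm
    linear_combination
      -Complex.I * (x + y * Complex.I) * (-Complex.I * p10 - p11
        + (m - Complex.I * η) * ψ (a + e z) 0 * hs)
      + (r * (x + y * Complex.I) * (partialDeriv2 ψ 0 (a + e z) 1 + η * ψ (a + e z) 0)
        + r * y * partialDeriv2 ψ 1 (a + e z) 1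
        + (x ^ 2 + y ^ 2 + Complex.I * x * y) * r⁻¹ / 2 * ψ (a + e z) 1) * Complex.I_sq
      + ψ (a + e z) 1 / 2 * hinv + r * (η + m * Complex.I) * ψ (a + e z) 0 * hzz
  · refine (norm_eq_of_mul_eq (w := x - y * Complex.I) hz
      (by rw [← hzc, Complex.norm_conj]) ?_).symm
    linear_combination
      -Complex.I * (x - y * Complex.I) * (-Complex.I * p00 + p01
        - (m + Complex.I * η) * ψ (a + e z) 1 * hs)
      + (r * (x - y * Complex.I) * (partialDeriv2 ψ 0 (a + e z) 0 + η * ψ (a + e z) 1)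
        + r * y * partialDeriv2 ψ 1 (a + e z) 0
        + (x ^ 2 + y ^ 2 - Complex.I * x * y) * r⁻¹ / 2 * ψ (a + e z) 0) * Complex.I_sq
      + ψ (a + e z) 0 / 2 * hinv
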